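/- Every smooth symmetric 2-tensor T_{ab} on U that is traceless, Σ_{a,b} h⁰^{ab}T_{ab} = 0, and curl-free, Σ_{c,d} ε_a{}^{cd} D_cT_{db} = 0, is divergence-free: D^bT_{ab} = Σ_{b,c} h⁰^{bc}D_cT_{ab} = 0 at every point of U. -/

import Mathlib

noncomputable section

/-- Points of the chart `U = ℝ × (0,π) × ℝ` with coordinates `(τ, θ, φ)`. -/
abbrev Pt : Type := Fin 3 → ℝ

/-- The coordinate domain `U = ℝ × (0,π) × ℝ`. -/
def U : Set Pt := {x | 0 < x 1 ∧ x 1 < Real.pi}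

/-- Partial derivative `∂_i f` at `x`. -/
noncomputable def pd (i : Fin 3) (f : Pt → ℝ) (x : Pt) : ℝ :=
  deriv (fun t => f (Function.update x i t)) (x i)

/-- The unit-hyperboloid (dS₃) metric `h⁰_{ab}`. -/
noncomputable def h0 (x : Pt) : Fin 3 → Fin 3 → ℝ :=
  ![![-1, 0, 0],
    ![0, Real.cosh (x 0) ^ 2, 0],
    ![0, 0, Real.cosh (x 0) ^ 2 * Real.sin (x 1) ^ 2]]

/-- The inverse metric `h⁰^{ab}`. -/
noncomputable def h0inv (x : Pt) : Fin 3 → Fin 3 → ℝ :=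
  ![![-1, 0, 0],
    ![0, 1 / Real.cosh (x 0) ^ 2, 0],
    ![0, 0, 1 / (Real.cosh (x 0) ^ 2 * Real.sin (x 1) ^ 2)]]

/-- Christoffel symbols `Γ^c_{ab}` of `h⁰`; first index is the upper index. -/
noncomputable def Chr (x : Pt) : Fin 3 → Fin 3 → Fin 3 → ℝ :=
  ![![![0, 0, 0],
      ![0, Real.sinh (x 0) * Real.cosh (x 0), 0],
      ![0, 0, Real.sinh (x 0) * Real.cosh (x 0) * Real.sin (x 1) ^ 2]],
    ![![0, Real.tanh (x 0), 0],
      ![Real.tanh (x 0), 0, 0],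
      ![0, 0, -(Real.sin (x 1) * Real.cos (x 1))]],
    ![![0, 0, Real.tanh (x 0)],
      ![0, 0, Real.cos (x 1) / Real.sin (x 1)],
      ![Real.tanh (x 0), Real.cos (x 1) / Real.sin (x 1), 0]]]

/-- Covariant Hessian `D_a D_b f = ∂_a ∂_b f - Σ_c Γ^c_{ab} ∂_c f`. -/
noncomputable def hess (f : Pt → ℝ) (x : Pt) (a b : Fin 3) : ℝ :=
  pd a (pd b f) x - ∑ c, Chr x c a b * pd c f x

/-- Covariant derivative `D_c T_{ab}` of a 2-tensor. -/
noncomputable def covD (T : Pt → Fin 3 → Fin 3 → ℝ) (x : Pt) (c a b : Fin 3) : ℝ :=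
  pd c (fun y => T y a b) x - (∑ d, Chr x d c a * T x d b) - (∑ d, Chr x d c b * T x a d)

/-- Second covariant derivative `D_d D_c T_{ab}`, treating `D_c T_{ab}` as a 3-tensor. -/
noncomputable def covD2 (T : Pt → Fin 3 → Fin 3 → ℝ) (x : Pt) (d c a b : Fin 3) : ℝ :=
  pd d (fun y => covD T y c a b) x
    - (∑ e, Chr x e d c * covD T x e a b)
    - (∑ e, Chr x e d a * covD T x c e b)
    - (∑ e, Chr x e d b * covD T x c a e)

/-- Tensor Laplacian `□T_{ab} = Σ_{c,d} h⁰^{cd} D_d D_c T_{ab}`. -/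
noncomputable def boxT (T : Pt → Fin 3 → Fin 3 → ℝ) (x : Pt) (a b : Fin 3) : ℝ :=
  ∑ c, ∑ d, h0inv x c d * covD2 T x d c a b

/-- Totally antisymmetric Levi-Civita symbol with `levi 0 1 2 = 1`. -/
def levi : Fin 3 → Fin 3 → Fin 3 → ℝ :=
  ![![![0, 0, 0], ![0, 0, 1], ![0, -1, 0]],
    ![![0, 0, -1], ![0, 0, 0], ![1, 0, 0]],
    ![![0, 1, 0], ![-1, 0, 0], ![0, 0, 0]]]

/-- Volume tensor `ε_{abc}` with `ε_{τθφ} = cosh²τ sinθ`. -/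
noncomputable def epsLow (x : Pt) (a b c : Fin 3) : ℝ :=
  levi a b c * (Real.cosh (x 0) ^ 2 * Real.sin (x 1))

/-- `ε_a{}^{cd} = Σ_{e,f} ε_{aef} h⁰^{ec} h⁰^{fd}`. -/
noncomputable def epsMixed (x : Pt) (a c d : Fin 3) : ℝ :=
  ∑ e, ∑ f, epsLow x a e f * h0inv x e c * h0inv x f d

/-- Curl of a 2-tensor: `(curl T)_{ab} = Σ_{c,d} ε_a{}^{cd} D_c T_{db}`. -/
noncomputable def curlT (T : Pt → Fin 3 → Fin 3 → ℝ) (x : Pt) (a b : Fin 3) : ℝ :=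
  ∑ c, ∑ d, epsMixed x a c d * covD T x c d b

lemma isOpen_U : IsOpen U :=
  (isOpen_lt continuous_const (continuous_apply 1)).inter
    (isOpen_lt (continuous_apply 1) continuous_const)

/-- Moving slightly along a coordinate line keeps a point of `U` inside `U`. -/
lemma eventually_update_mem_U {x : Pt} (hx : x ∈ U) (i : Fin 3) :
    ∀ᶠ t in nhds (x i), Function.update x i t ∈ U := by
  have hc : Continuous (fun t : ℝ => Function.update x i t) :=
    continuous_const.update i continuous_id
  exact hc.continuousAt.eventually_mem
    (by simpa using isOpen_U.mem_nhds hx)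

/-- On `U`, the partial derivatives of a smooth function are genuine derivatives. -/
lemma hasDerivAt_pd {f : Pt → ℝ} (hf : ContDiffOn ℝ (⊤ : ℕ∞) f U) {x : Pt} (hx : x ∈ U)
    (i : Fin 3) : HasDerivAt (fun t => f (Function.update x i t)) (pd i f x) (x i) := by
  have hd : DifferentiableAt ℝ f (Function.update x i (x i)) := by
    rw [Function.update_eq_self]
    exact (hf.differentiableOn (by simp)).differentiableAt (isOpen_U.mem_nhds hx)
  exact (hd.comp (x i) (hasDerivAt_update x i (x i)).differentiableAt).hasDerivAt

/-- Vanishing curl means that `D_c T_{db}` is symmetric in `c` and `d`. -/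
lemma covD_swap_of_curlT_eq_zero {T : Pt → Fin 3 → Fin 3 → ℝ} {x : Pt} (hx : x ∈ U)
    (hcurl : ∀ a b : Fin 3, curlT T x a b = 0) (c d b : Fin 3) :
    covD T x c d b = covD T x d c b := by
  have hC : Real.cosh (x 0) ≠ 0 := (Real.cosh_pos _).ne'
  have hS : Real.sin (x 1) ≠ 0 := (Real.sin_pos_of_pos_of_lt_pi hx.1 hx.2).ne'
  have e0 := hcurl 0 b
  have e1 := hcurl 1 b
  have e2 := hcurl 2 b
  simp only [curlT, epsMixed, epsLow, levi, h0inv, Fin.sum_univ_three, Matrix.cons_val,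
    zero_mul, mul_zero, add_zero, zero_add] at e0 e1 e2
  field_simp at e0 e1 e2
  have e2' := (mul_eq_zero.1 e2).resolve_left hS
  fin_cases c <;> fin_cases d <;> simp only [Fin.mk_one, Fin.reduceFinMk, Fin.zero_eta] <;>
    linarith

/-- By metric compatibility, the trace of `D_c T` vanishes when the trace of `T` does. -/
lemma trace_covD_eq_zero {T : Pt → Fin 3 → Fin 3 → ℝ}
    (hT : ∀ a b : Fin 3, ContDiffOn ℝ (⊤ : ℕ∞) (fun x => T x a b) U)
    (hsym : ∀ x ∈ U, ∀ a b : Fin 3, T x a b = T x b a)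
    (htr : ∀ x ∈ U, (∑ a, ∑ b, h0inv x a b * T x a b) = 0) {x : Pt} (hx : x ∈ U)
    (a : Fin 3) : (∑ b, ∑ c, h0inv x b c * covD T x a c b) = 0 := by
  have hC : Real.cosh (x 0) ≠ 0 := (Real.cosh_pos _).ne'
  have hS : Real.sin (x 1) ≠ 0 := (Real.sin_pos_of_pos_of_lt_pi hx.1 hx.2).ne'
  have hg : ∀ y ∈ U, T y 0 0 * (Real.cosh (y 0) ^ 2 * Real.sin (y 1) ^ 2)
      = T y 1 1 * Real.sin (y 1) ^ 2 + T y 2 2 := by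
    intro y hy
    have hC : Real.cosh (y 0) ≠ 0 := (Real.cosh_pos _).ne'
    have hS : Real.sin (y 1) ≠ 0 := (Real.sin_pos_of_pos_of_lt_pi hy.1 hy.2).ne'
    have h := htr y hy
    simp only [h0inv, Fin.sum_univ_three, Matrix.cons_val, zero_mul, add_zero, zero_add] at h
    field_simp at h
    linarith
  have hgx := hg x hx
  have hcoord : ∀ i : Fin 3, HasDerivAt (fun t => Function.update x a t i)
      ((Pi.single a (1 : ℝ) : Pt) i) (x a) :=
    hasDerivAt_pi.1 (hasDerivAt_update x a (x a))
  have dC := ((hcoord 0).cosh).pow 2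
  have dS := ((hcoord 1).sin).pow 2
  have d0 := (hasDerivAt_pd (hT 0 0) hx a).mul (dC.mul dS)
  have d1 := ((hasDerivAt_pd (hT 1 1) hx a).mul dS).add (hasDerivAt_pd (hT 2 2) hx a)
  have key := (d0.congr_of_eventuallyEq
    ((eventually_update_mem_U hx a).mono fun t ht => (hg _ ht).symm)).unique d1
  simp only [Function.update_eq_self, Pi.mul_apply, Pi.pow_apply] at key
  have s10 := hsym x hx 1 0
  have s20 := hsym x hx 2 0
  have s21 := hsym x hx 2 1
  simp only [covD, h0inv, Chr, Fin.sum_univ_three, Matrix.cons_val, Real.tanh_eq_sinh_div_cosh,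
    s10, s20, s21]
  clear d0 d1 dC dS hcoord hg hT htr hsym
  fin_cases a <;> simp at key ⊢ <;> field_simp
  · linear_combination (-Real.cosh (x 0)) * key + 2 * Real.sinh (x 0) * hgx
  · linear_combination (-Real.sin (x 1)) * key + 2 * Real.cos (x 1) * hgx
  · linear_combination -key

/-- Every smooth symmetric traceless curl-free 2-tensor on `U` is divergence-free. -/
theorem stmt9 (T : Pt → Fin 3 → Fin 3 → ℝ)
    (hT : ∀ a b : Fin 3, ContDiffOn ℝ (⊤ : ℕ∞) (fun x => T x a b) U)
    (hsym : ∀ x ∈ U, ∀ a b : Fin 3, T x a b = T x b a)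
    (htr : ∀ x ∈ U, (∑ a, ∑ b, h0inv x a b * T x a b) = 0)
    (hcurl : ∀ x ∈ U, ∀ a b : Fin 3, curlT T x a b = 0) :
    ∀ x ∈ U, ∀ a : Fin 3, (∑ b, ∑ c, h0inv x b c * covD T x c a b) = 0 := by
  intro x hx a
  rw [← trace_covD_eq_zero hT hsym htr hx a]
  refine Finset.sum_congr rfl fun b _ => Finset.sum_congr rfl fun c _ => ?_
  rw [covD_swap_of_curlT_eq_zero hx (hcurl x hx) c a b]
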